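/- If C is weakly separable for N_p, then for every cluster c ∈ C and every point z ∈ c, the ε-cluster centered at z with radius ε*(c) satisfies c*(z, ε*(c)) = c; in particular, every cluster of C is an ε*(c)-cluster (a maximal cluster). -/

import Mathlib

variable {α : Type*}

/-- Sparsity ε_{N_p}(x): smallest ε ≥ 0 such that at least N_p points of X lie within
distance ε of x. -/
noncomputable def sparsity [MetricSpace α] (X : Finset α) (Np : ℕ) (x : α) : ℝ :=
  sInf {ε : ℝ | 0 ≤ ε ∧ Np ≤ (X.filter (fun y => dist x y ≤ ε)).card}

/-- x is ε-connected to y: there is a finite sequence of points of X from x to y,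
each of sparsity at most ε, with consecutive distances at most ε. -/
def EpsConn [MetricSpace α] (X : Finset α) (Np : ℕ) (ε : ℝ) (x y : α) : Prop :=
  x ∈ X ∧ sparsity X Np x ≤ ε ∧
    Relation.ReflTransGen (fun a b => b ∈ X ∧ sparsity X Np b ≤ ε ∧ dist a b ≤ ε) x y

/-- A set c is ε-connected if every pair of points of c is ε-connected. -/
def SetConn [MetricSpace α] (X : Finset α) (Np : ℕ) (ε : ℝ) (c : Finset α) : Prop :=
  ∀ x ∈ c, ∀ y ∈ c, EpsConn X Np ε x y

/-- ε*(c): the minimum ε such that c is ε-connected. -/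
noncomputable def setSparsity [MetricSpace α] (X : Finset α) (Np : ℕ) (c : Finset α) : ℝ :=
  sInf {ε : ℝ | SetConn X Np ε c}

/-- ε(x,y): the minimum ε such that x is ε-connected to y. -/
noncomputable def epsDist [MetricSpace α] (X : Finset α) (Np : ℕ) (x y : α) : ℝ :=
  sInf {ε : ℝ | EpsConn X Np ε x y}

/-- ε(x,c): min over y ∈ c of ε(x,y). -/
noncomputable def ptClusterDist [MetricSpace α] (X : Finset α) (Np : ℕ) (x : α)
    (c : Finset α) : ℝ :=
  sInf {e : ℝ | ∃ y ∈ c, e = epsDist X Np x y}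

/-- ε(c,c'): min over x ∈ c, y ∈ c' of ε(x,y). -/
noncomputable def clusterDist [MetricSpace α] (X : Finset α) (Np : ℕ)
    (c c' : Finset α) : ℝ :=
  sInf {e : ℝ | ∃ x ∈ c, ∃ y ∈ c', e = epsDist X Np x y}

/-- A clustering of X: a partition of X into nonempty clusters. -/
def IsClustering (X : Finset α) (C : Finset (Finset α)) : Prop :=
  (∀ c ∈ C, c.Nonempty) ∧ (∀ c ∈ C, ∀ c' ∈ C, c ≠ c' → Disjoint c c') ∧
    (∀ c ∈ C, c ⊆ X) ∧ (∀ x ∈ X, ∃ c ∈ C, x ∈ c)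

/-- C is weakly separable: for each cluster c, ε*(c) < min over c' ≠ c of ε(c,c'). -/
def WeaklySeparable [MetricSpace α] (X : Finset α) (Np : ℕ) (C : Finset (Finset α)) : Prop :=
  ∀ c ∈ C, ∀ c' ∈ C, c' ≠ c → setSparsity X Np c < clusterDist X Np c c'

/-- c is an ε-cluster: a (nonempty) maximal ε-connected subset of X. -/
def IsEpsCluster [MetricSpace α] (X : Finset α) (Np : ℕ) (ε : ℝ) (c : Finset α) : Prop :=
  c.Nonempty ∧ SetConn X Np ε c ∧ ∀ x ∈ X, (∃ y ∈ c, EpsConn X Np ε x y) → x ∈ c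

/-- c is a maximal cluster: an ε-cluster for some ε ≥ 0. -/
def IsMaximalCluster [MetricSpace α] (X : Finset α) (Np : ℕ) (c : Finset α) : Prop :=
  ∃ ε : ℝ, 0 ≤ ε ∧ IsEpsCluster X Np ε c

/-- x is a local maximum: every y ∈ X with d(x,y) ≤ ε_{N_p}(x) has sparsity ≥ that of x. -/
def IsLocalMaxPt [MetricSpace α] (X : Finset α) (Np : ℕ) (x : α) : Prop :=
  x ∈ X ∧ ∀ y ∈ X, dist x y ≤ sparsity X Np x → sparsity X Np x ≤ sparsity X Np y

/-- X_c*: the points of c of minimum sparsity within c. -/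
noncomputable def minSparsityPts [MetricSpace α] (X : Finset α) (Np : ℕ)
    (c : Finset α) : Finset α :=
  c.filter (fun x => ∀ y ∈ c, sparsity X Np x ≤ sparsity X Np y)

/-- Relative separability A(x,y) = ε(x,y) / ε_{N_p}(x). -/
noncomputable def relSep [MetricSpace α] (X : Finset α) (Np : ℕ) (x y : α) : ℝ :=
  epsDist X Np x y / sparsity X Np x

/-- A(x,c) = min over y ∈ c of A(x,y). -/
noncomputable def relSepCluster [MetricSpace α] (X : Finset α) (Np : ℕ) (x : α)
    (c : Finset α) : ℝ :=
  sInf {a : ℝ | ∃ y ∈ c, a = relSep X Np x y}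

/-- A^ℓ(C): the minimum A such that for every local maximum x, every y in the cluster of x
with sparsity at most that of x satisfies A(x,y) ≤ A. -/
noncomputable def Aell [MetricSpace α] (X : Finset α) (Np : ℕ)
    (C : Finset (Finset α)) : ℝ :=
  sInf {A : ℝ | ∀ x ∈ X, IsLocalMaxPt X Np x → ∀ c ∈ C, x ∈ c →
    ∀ y ∈ c, sparsity X Np y ≤ sparsity X Np x → relSep X Np x y ≤ A}

/-- C is LM-separable: A^ℓ(C) < min over distinct clusters c, c' and z ∈ X_c* of A(z,c'). -/
def LMSeparable [MetricSpace α] (X : Finset α) (Np : ℕ) (C : Finset (Finset α)) : Prop :=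
  ∀ c ∈ C, ∀ c' ∈ C, c ≠ c' → ∀ z ∈ minSparsityPts X Np c,
    Aell X Np C < relSepCluster X Np z c'

/-- min over x ∈ c of ε_{N_p}(x). -/
noncomputable def minSpars [MetricSpace α] (X : Finset α) (Np : ℕ) (c : Finset α) : ℝ :=
  sInf (sparsity X Np '' (c : Set α))

/-- max over x ∈ c of ε_{N_p}(x). -/
noncomputable def maxSpars [MetricSpace α] (X : Finset α) (Np : ℕ) (c : Finset α) : ℝ :=
  sSup (sparsity X Np '' (c : Set α))

/-- C is strongly separable: there is an A such that each cluster c is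
(A · min sparsity of c)-connected and A · min sparsity of c < min over c' ≠ c of ε(c,c'). -/
def StronglySeparable [MetricSpace α] (X : Finset α) (Np : ℕ)
    (C : Finset (Finset α)) : Prop :=
  ∃ A : ℝ, ∀ c ∈ C, SetConn X Np (A * minSpars X Np c) c ∧
    ∀ c' ∈ C, c' ≠ c → A * minSpars X Np c < clusterDist X Np c c'

/-- c*(x,ε): the set of points of X that are ε-connected to x. -/
def epsClusterAt [MetricSpace α] (X : Finset α) (Np : ℕ) (ε : ℝ) (x : α) : Set α :=
  {y | EpsConn X Np ε x y}

open Filter Topology in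
/-- The finitely many values of `f` on `s` that are at most `ε` are at most `t` once `ε ≥ t` is
close enough to `t`. -/
theorem eventually_forall_le_imp_le {ι : Type*} (s : Finset ι) (f : ι → ℝ) (t : ℝ) :
    ∀ᶠ ε in 𝓝 t, ∀ i ∈ s, f i ≤ ε → f i ≤ t := by
  rw [Filter.eventually_all_finset]
  intro i _
  by_cases h : f i ≤ t
  · exact Eventually.of_forall fun _ _ => h
  · filter_upwards [gt_mem_nhds (not_le.mp h)] with ε hε hle
    exact absurd hle (not_le.mpr hε)

section

variable [MetricSpace α] {X : Finset α} {Np : ℕ} {ε δ : ℝ} {x y : α} {c c' : Finset α}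

theorem sparsity_nonneg (X : Finset α) (Np : ℕ) (x : α) : 0 ≤ sparsity X Np x :=
  Real.sInf_nonneg fun _ h => h.1

theorem EpsConn.nonneg (h : EpsConn X Np ε x y) : 0 ≤ ε :=
  (sparsity_nonneg X Np x).trans h.2.1

theorem EpsConn.symm (h : EpsConn X Np ε x y) : EpsConn X Np ε y x := by
  obtain ⟨hx, hs, hp⟩ := h
  induction hp with
  | refl => exact ⟨hx, hs, .refl⟩
  | tail _ hbc ih =>
    exact ⟨hbc.1, hbc.2.1, .head ⟨ih.1, ih.2.1, by rw [dist_comm]; exact hbc.2.2⟩ ih.2.2⟩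

theorem EpsConn.of_le_imp_le (h : EpsConn X Np ε x y)
    (hs : ∀ a ∈ X, sparsity X Np a ≤ ε → sparsity X Np a ≤ δ)
    (hd : ∀ p ∈ X ×ˢ X, dist p.1 p.2 ≤ ε → dist p.1 p.2 ≤ δ) : EpsConn X Np δ x y := by
  obtain ⟨hx, hsx, hp⟩ := h
  have key : y ∈ X ∧ EpsConn X Np δ x y := by
    induction hp with
    | refl => exact ⟨hx, hx, hs x hx hsx, .refl⟩
    | tail _ hbc ih =>
      exact ⟨hbc.1, hx, hs x hx hsx, ih.2.2.2.tail ⟨hbc.1, hs _ hbc.1 hbc.2.1,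
        hd (_, _) (Finset.mk_mem_product ih.1 hbc.1) hbc.2.2⟩⟩
  exact key.2

theorem exists_setConn (Np : ℕ) (hc : c ⊆ X) : ∃ ε, SetConn X Np ε c := by
  obtain ⟨M, hM⟩ := (X.image (sparsity X Np)).bddAbove
  obtain ⟨D, hD⟩ := ((X ×ˢ X).image fun p => dist p.1 p.2).bddAbove
  have hM' : ∀ a ∈ X, sparsity X Np a ≤ max M D := fun a ha =>
    (hM (Finset.mem_coe.mpr (Finset.mem_image_of_mem _ ha))).trans (le_max_left _ _)
  refine ⟨max M D, fun x hx y hy => ⟨hc hx, hM' x (hc hx), .single ⟨hc hy, hM' y (hc hy), ?_⟩⟩⟩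
  exact (hD (Finset.mem_coe.mpr (Finset.mem_image_of_mem (fun p : α × α => dist p.1 p.2)
    (Finset.mk_mem_product (hc hx) (hc hy))))).trans (le_max_right _ _)

/-- The infimum defining `setSparsity` is attained. -/
theorem setConn_setSparsity (hc : c ⊆ X) : SetConn X Np (setSparsity X Np c) c := by
  intro x hx y hy
  have hbdd : BddBelow {ε : ℝ | SetConn X Np ε c} := ⟨0, fun ε h => (h x hx x hx).nonneg⟩
  have hfreq := (isGLB_csInf (exists_setConn Np hc) hbdd).frequently_nhds_mem
    (exists_setConn Np hc)
  obtain ⟨ε, hε, hs, hd⟩ := (hfreq.and_eventually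
    ((eventually_forall_le_imp_le X (sparsity X Np) (setSparsity X Np c)).and
      (eventually_forall_le_imp_le (X ×ˢ X) (fun p => dist p.1 p.2)
        (setSparsity X Np c)))).exists
  exact (hε x hx y hy).of_le_imp_le hs hd

theorem epsDist_nonneg (X : Finset α) (Np : ℕ) (x y : α) : 0 ≤ epsDist X Np x y :=
  Real.sInf_nonneg fun _ h => EpsConn.nonneg h

theorem EpsConn.clusterDist_le (h : EpsConn X Np ε x y) (hx : x ∈ c) (hy : y ∈ c') :
    clusterDist X Np c c' ≤ ε := by
  have h₁ : clusterDist X Np c c' ≤ epsDist X Np x y := by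
    refine csInf_le ⟨0, ?_⟩ ⟨x, hx, y, hy, rfl⟩
    rintro _ ⟨a, _, b, _, rfl⟩
    exact epsDist_nonneg X Np a b
  exact h₁.trans (csInf_le ⟨0, fun _ h' => EpsConn.nonneg h'⟩ h)

theorem WeaklySeparable.mem_of_epsConn {C : Finset (Finset α)} (hW : WeaklySeparable X Np C)
    (hC : IsClustering X C) (hc : c ∈ C) (hx : x ∈ c)
    (h : EpsConn X Np (setSparsity X Np c) x y) : y ∈ c := by
  obtain ⟨c', hc', hy⟩ := hC.2.2.2 y h.symm.1
  by_cases hne : c' = c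
  · exact hne ▸ hy
  · exact absurd (h.clusterDist_le hx hy) (not_le.mpr (hW c hc c' hc' hne))

end

/-- if C is weakly separable, then for each cluster c and each z ∈ c,
c*(z, ε*(c)) = c; in particular c is an ε*(c)-cluster. -/
theorem stmt_9 {α : Type*} [MetricSpace α] (X : Finset α) (Np : ℕ)
    (hNp : 0 < Np) (hNpX : Np ≤ X.card)
    (C : Finset (Finset α)) (hC : IsClustering X C) (hW : WeaklySeparable X Np C) :
    ∀ c ∈ C, (∀ z ∈ c, epsClusterAt X Np (setSparsity X Np c) z = (c : Set α)) ∧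
      IsEpsCluster X Np (setSparsity X Np c) c := by
  intro c hc
  have hconn : SetConn X Np (setSparsity X Np c) c := setConn_setSparsity (hC.2.2.1 c hc)
  refine ⟨fun z hz => Set.ext fun y => ⟨fun h => hW.mem_of_epsConn hC hc hz h,
    fun hy => hconn z hz y hy⟩, hC.1 c hc, hconn, ?_⟩
  rintro x _ ⟨y, hy, h⟩
  exact hW.mem_of_epsConn hC hc hy h.symm
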